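/- arXiv:1503.06112 — 3 statements merged into one kernel-verified Lean document; each statement's English description precedes it below -/
import Mathlib

section
/- Let X = (c₀, |‖·‖|) be Read's space. If Y ⊆ X is a closed linear subspace of finite codimension such that Y⊥ ⊆ NA(X), then the quotient space X/Y (with the quotient norm induced by |‖·‖|) is strictly convex. -/
/-- The space `c₀` of real sequences converging to `0`, with the supremum norm. -/
abbrev CZero := ZeroAtInftyContinuousMap ℕ ℝ

/-- The pairing `⟨x, u - e_a⟩` of `x ∈ c₀` with `u - e_a ∈ ℓ₁`, where `u` is a finitely
supported sequence of rationals and `e_a` is the `a`-th canonical unit vector. -/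
noncomputable def readPairing (u : ℕ →₀ ℚ) (a : ℕ) (x : CZero) : ℝ :=
  (∑ j ∈ u.support, (u j : ℝ) * x j) - x a

/-- `N` is *Read's norm* on `c₀`: there are a sequence `(uₙ)` of finitely supported rational
sequences listing every such sequence infinitely many times, and a strictly increasing
sequence `(aₙ)` of positive integers with `aₙ > max supp uₙ` and `aₙ ≥ ‖uₙ‖₁`, such that
`N x = ‖x‖∞ + Σₙ 2^(-aₙ²) |⟨x, uₙ - e_{aₙ}⟩|`. -/
def IsReadNorm (N : CZero → ℝ) : Prop :=
  ∃ (u : ℕ → (ℕ →₀ ℚ)) (a : ℕ → ℕ),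
    (∀ v : ℕ →₀ ℚ, {n : ℕ | u n = v}.Infinite) ∧
    StrictMono a ∧
    (∀ n, 0 < a n) ∧
    (∀ n, ∀ j ∈ (u n).support, j < a n) ∧
    (∀ n, (∑ j ∈ (u n).support, |((u n) j : ℝ)|) ≤ (a n : ℝ)) ∧
    (∀ x : CZero, N x = ‖x‖ +
      ∑' n : ℕ, (2 : ℝ) ^ (-((a n : ℤ) ^ 2)) * |readPairing (u n) (a n) x|)

/-- A continuous linear functional `f` attains its norm with respect to the (equivalent)
norm `N`: there is `x` in the `N`-closed unit ball at which `f` equals its supremum over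
that ball (i.e. its `N`-dual norm). -/
def AttainsWrt {X : Type*} [SeminormedAddCommGroup X] [NormedSpace ℝ X] (N : X → ℝ)
    (f : X →L[ℝ] ℝ) : Prop :=
  ∃ x : X, N x ≤ 1 ∧ f x = sSup ((fun z => f z) '' {z : X | N z ≤ 1})

/-- The quotient norm on `X ⧸ Y` induced by the norm `N` on `X`. -/
noncomputable def quotNormOf {X : Type*} [NormedAddCommGroup X] [NormedSpace ℝ X]
    (Y : Submodule ℝ X) (N : X → ℝ) (w : X ⧸ Y) : ℝ :=
  sInf (N '' {x : X | (Submodule.Quotient.mk x : X ⧸ Y) = w})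

/-- unit vectors -/
noncomputable def cUnit (j : ℕ) : CZero where
  toFun := fun i => if i = j then 1 else 0
  continuous_toFun := continuous_of_discreteTopology
  zero_at_infty' := by
    rw [Filter.cocompact_eq_cofinite]
    refine tendsto_const_nhds.congr' ?_
    have : ∀ᶠ i in Filter.cofinite, i ≠ j := (Set.finite_singleton j).compl_mem_cofinite
    filter_upwards [this] with i hi
    simp [hi]

lemma cUnit_apply (j i : ℕ) : cUnit j i = if i = j then 1 else 0 := rfl

lemma cz_abs_le (x : CZero) (i : ℕ) : |x i| ≤ ‖x‖ := by
  have := x.toBCF.norm_coe_le_norm i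
  simpa using this

lemma cz_norm_le (x : CZero) {C : ℝ} (hC : 0 ≤ C) (h : ∀ i, |x i| ≤ C) : ‖x‖ ≤ C := by
  have := (BoundedContinuousFunction.norm_le (f := x.toBCF) hC).2 (fun i => by simpa using h i)
  simpa using this

lemma cz_sum_apply (F : Finset ℕ) (c : ℕ → ℝ) (i : ℕ) :
    (∑ j ∈ F, c j • cUnit j) i = if i ∈ F then c i else 0 := by
  classical
  induction F using Finset.induction_on with
  | empty => simp
  | insert a s ha ih =>
    rw [Finset.sum_insert ha, ZeroAtInftyContinuousMap.add_apply, ih,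
      ZeroAtInftyContinuousMap.smul_apply, cUnit_apply]
    by_cases h : i = a
    · subst h; simp [ha]
    · simp [h]

lemma cz_summable (f : CZero →L[ℝ] ℝ) : Summable (fun j => |f (cUnit j)|) := by
  refine summable_of_sum_le (c := ‖f‖) (fun _ => abs_nonneg _) (fun F => ?_)
  set x : CZero := ∑ j ∈ F, (SignType.sign (f (cUnit j)) : ℝ) • cUnit j with hx
  have h1 : ‖x‖ ≤ 1 := by
    refine cz_norm_le x zero_le_one (fun i => ?_)
    rw [hx, cz_sum_apply]
    split_ifs
    · rcases lt_trichotomy (f (cUnit i)) 0 with h | h | h <;> simp [h]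
    · simp
  have h2 : f x = ∑ j ∈ F, |f (cUnit j)| := by
    rw [hx, map_sum]
    refine Finset.sum_congr rfl (fun j _ => ?_)
    rw [map_smul, smul_eq_mul, sign_mul_self]
  rw [← h2]
  calc f x ≤ ‖f x‖ := Real.le_norm_self _
    _ ≤ ‖f‖ * ‖x‖ := f.le_opNorm x
    _ ≤ ‖f‖ * 1 := by gcongr
    _ = ‖f‖ := mul_one _

lemma cz_trunc (x : CZero) :
    Filter.Tendsto (fun M => ∑ j ∈ Finset.range M, x j • cUnit j) Filter.atTop (nhds x) := by
  rw [Metric.tendsto_atTop]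
  intro ε hε
  have h0 : Filter.Tendsto x Filter.atTop (nhds 0) := by
    have := x.zero_at_infty'
    rw [Filter.cocompact_eq_cofinite, Nat.cofinite_eq_atTop] at this
    exact this
  rw [Metric.tendsto_atTop] at h0
  obtain ⟨K, hK⟩ := h0 (ε / 2) (by positivity)
  refine ⟨K, fun M hM => ?_⟩
  rw [dist_eq_norm]
  refine lt_of_le_of_lt (cz_norm_le _ (C := ε / 2) (by positivity) (fun i => ?_)) (by linarith)
  rw [ZeroAtInftyContinuousMap.sub_apply, cz_sum_apply]
  split_ifs with h
  · simp; positivity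
  · have hi : K ≤ i := by simp at h; omega
    have := hK i hi
    rw [Real.dist_eq] at this
    rw [zero_sub, abs_neg]
    simpa using this.le

lemma cz_sum_bound (F : Finset ℕ) (c : ℕ → ℝ) (x : CZero) :
    |∑ j ∈ F, c j * x j| ≤ (∑ j ∈ F, |c j|) * ‖x‖ := by
  refine (Finset.abs_sum_le_sum_abs _ _).trans ?_
  rw [Finset.sum_mul]
  refine Finset.sum_le_sum (fun j _ => ?_)
  rw [abs_mul]
  exact mul_le_mul_of_nonneg_left (cz_abs_le x j) (abs_nonneg _)

lemma cz_approx (f : CZero →L[ℝ] ℝ) :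
    ∃ u : ℕ →₀ ℚ, ∀ x : CZero, |f x - ∑ j ∈ u.support, (u j : ℝ) * x j| ≤ ‖x‖ := by
  obtain ⟨s, hs⟩ := summable_iff_vanishing_norm.1 (cz_summable f) (1/2) (by norm_num)
  obtain ⟨m, hm⟩ : ∃ m, s ⊆ Finset.range m := s.exists_nat_subset_range
  have hq : ∀ j, ∃ q : ℚ, |f (cUnit j) - q| ≤ 1 / (2 * (m + 1)) := fun j => by
    obtain ⟨q, hq⟩ := exists_rat_near (f (cUnit j)) (show (0:ℝ) < 1 / (2 * (m + 1)) by positivity)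
    exact ⟨q, hq.le⟩
  choose q hq using hq
  classical
  refine ⟨Finsupp.onFinset (Finset.range m) (fun j => if j ∈ Finset.range m then q j else 0)
    (fun j hj => by by_contra h; simp [h] at hj), fun x => ?_⟩
  have hsum : ∑ j ∈ (Finsupp.onFinset (Finset.range m)
      (fun j => if j ∈ Finset.range m then q j else 0)
      (fun j hj => by by_contra h; simp [h] at hj)).support,
      (((Finsupp.onFinset (Finset.range m) (fun j => if j ∈ Finset.range m then q j else 0)
      (fun j hj => by by_contra h; simp [h] at hj)) j : ℚ) : ℝ) * x j
      = ∑ j ∈ Finset.range m, (q j : ℝ) * x j := by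
    rw [Finset.sum_subset (Finsupp.support_onFinset_subset)]
    · refine Finset.sum_congr rfl (fun j hj => ?_)
      rw [Finsupp.onFinset_apply, if_pos hj]
    · intro j _ hj
      rw [Finsupp.notMem_support_iff] at hj
      rw [hj]; simp
  rw [hsum]
  have hA : |f x - ∑ j ∈ Finset.range m, f (cUnit j) * x j| ≤ 1 / 2 * ‖x‖ := by
    have ht : Filter.Tendsto (fun M => |f (∑ j ∈ Finset.range M, x j • cUnit j)
        - ∑ j ∈ Finset.range m, f (cUnit j) * x j|) Filter.atTop
        (nhds |f x - ∑ j ∈ Finset.range m, f (cUnit j) * x j|) :=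
      (((f.continuous.tendsto x).comp (cz_trunc x)).sub_const _).abs
    refine le_of_tendsto ht ?_
    filter_upwards [Filter.eventually_ge_atTop m] with M hM
    have : f (∑ j ∈ Finset.range M, x j • cUnit j) - ∑ j ∈ Finset.range m, f (cUnit j) * x j
        = ∑ j ∈ Finset.Ico m M, f (cUnit j) * x j := by
      rw [Finset.sum_Ico_eq_sub _ hM, map_sum]
      congr 1
      exact Finset.sum_congr rfl (fun j _ => by rw [map_smul, smul_eq_mul, mul_comm])
    rw [this]
    refine (cz_sum_bound _ _ x).trans ?_
    refine mul_le_mul_of_nonneg_right ?_ (norm_nonneg _)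
    have h3 := hs (Finset.Ico m M) (by
      rw [Finset.disjoint_left]
      intro j hj hjs
      have := hm hjs
      simp at hj this
      omega)
    exact (Real.le_norm_self _).trans h3.le
  have hB : |∑ j ∈ Finset.range m, (f (cUnit j) - q j) * x j| ≤ 1 / 2 * ‖x‖ := by
    refine (cz_sum_bound _ _ x).trans ?_
    refine mul_le_mul_of_nonneg_right ?_ (norm_nonneg _)
    refine (Finset.sum_le_sum (fun j _ => hq j)).trans ?_
    rw [Finset.sum_const, Finset.card_range, nsmul_eq_mul]
    have : (0:ℝ) ≤ m := Nat.cast_nonneg m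
    rw [mul_one_div, div_le_iff₀ (by positivity)]
    linarith
  have e : f x - ∑ j ∈ Finset.range m, (q j : ℝ) * x j
      = (f x - ∑ j ∈ Finset.range m, f (cUnit j) * x j)
        + ∑ j ∈ Finset.range m, (f (cUnit j) - q j) * x j := by
    simp only [sub_mul, Finset.sum_sub_distrib]; ring
  rw [e]
  refine (abs_add_le _ _).trans ?_
  linarith

lemma read_weight (a n : ℕ) (h : n + 1 ≤ a) :
    (2 : ℝ) ^ (-((a : ℤ) ^ 2)) * (a + 1) ≤ (1 / 2) ^ n := by
  have h1 : ((a : ℝ) + 1) ≤ 2 ^ a := by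
    exact_mod_cast Nat.lt_two_pow_self
  have h2 : (2 : ℝ) ^ (-((a : ℤ) ^ 2)) = (2 ^ (a ^ 2))⁻¹ := by
    rw [zpow_neg]; congr 1
  rw [h2, one_div, inv_pow, inv_mul_le_iff₀ (by positivity), ← div_eq_mul_inv,
    le_div_iff₀ (by positivity)]
  calc ((a : ℝ) + 1) * 2 ^ n ≤ 2 ^ a * 2 ^ n := by gcongr
    _ = 2 ^ (a + n) := by rw [pow_add]
    _ ≤ 2 ^ (a ^ 2) := by
      apply pow_le_pow_right₀ (by norm_num)
      nlinarith

lemma readPairing_add (u : ℕ →₀ ℚ) (a : ℕ) (x y : CZero) :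
    readPairing u a (x + y) = readPairing u a x + readPairing u a y := by
  simp only [readPairing, ZeroAtInftyContinuousMap.add_apply, mul_add, Finset.sum_add_distrib]
  ring

lemma readPairing_smul (u : ℕ →₀ ℚ) (a : ℕ) (c : ℝ) (x : CZero) :
    readPairing u a (c • x) = c * readPairing u a x := by
  simp only [readPairing, ZeroAtInftyContinuousMap.smul_apply, smul_eq_mul, mul_sub,
    Finset.mul_sum]
  congr 1
  exact Finset.sum_congr rfl (fun j _ => by ring)

lemma qn_smul (Y : Submodule ℝ CZero) (N : CZero → ℝ)
    (hsm : ∀ (c : ℝ) x, 0 < c → N (c • x) = c * N x) (c : ℝ) (hc : 0 < c) (w : CZero ⧸ Y) :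
    quotNormOf Y N (c • w) = c * quotNormOf Y N w := by
  unfold quotNormOf
  rw [← smul_eq_mul, ← Real.sInf_smul_of_nonneg hc.le]
  congr 1
  ext r
  simp only [Set.mem_image, Set.mem_ofPred_eq, Set.mem_smul_set]
  constructor
  · rintro ⟨x, hx, rfl⟩
    refine ⟨N (c⁻¹ • x), ⟨c⁻¹ • x, ?_, rfl⟩, ?_⟩
    · rw [Submodule.Quotient.mk_smul, hx, inv_smul_smul₀ hc.ne']
    · rw [smul_eq_mul, ← hsm _ _ hc, smul_inv_smul₀ hc.ne']
  · rintro ⟨_, ⟨x, hx, rfl⟩, rfl⟩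
    exact ⟨c • x, by rw [Submodule.Quotient.mk_smul, hx], by rw [hsm _ _ hc, smul_eq_mul]⟩

/-- Let `X = (c₀, N)` be Read's space.  If `Y ⊆ X` is a closed linear
subspace of finite codimension such that `Y⊥ ⊆ NA(X)`, then the quotient `X ⧸ Y`, with the
quotient norm induced by `N`, is strictly convex (no nontrivial segment on its unit
sphere). -/
theorem stmt16 (N : CZero → ℝ) (hN : IsReadNorm N)
    (Y : Submodule ℝ CZero) (hYc : IsClosed (Y : Set CZero))
    [FiniteDimensional ℝ (CZero ⧸ Y)]
    (hNA : ∀ f : CZero →L[ℝ] ℝ, (∀ y ∈ Y, f y = 0) → AttainsWrt N f) :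
    ∀ w₁ w₂ : CZero ⧸ Y, quotNormOf Y N w₁ = 1 → quotNormOf Y N w₂ = 1 → w₁ ≠ w₂ →
      quotNormOf Y N (w₁ + w₂) < 2 := by
  intro w₁ w₂ h₁ h₂ hne
  obtain ⟨u, a, hu, ha, hapos, hasupp, hal1, hNeq⟩ := hN
  have hage : ∀ n, n + 1 ≤ a n := by
    intro n
    induction n with
    | zero => exact hapos 0
    | succ k ih => have := ha (show k < k + 1 by omega); omega
  have hpair : ∀ n x, |readPairing (u n) (a n) x| ≤ ((a n : ℝ) + 1) * ‖x‖ := by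
    intro n x
    unfold readPairing
    refine (abs_sub _ _).trans ?_
    have h3 := (cz_sum_bound (u n).support (fun j => ((u n) j : ℝ)) x).trans
      (mul_le_mul_of_nonneg_right (hal1 n) (norm_nonneg x))
    have h4 := cz_abs_le x (a n)
    linarith
  have hsumm : ∀ x, Summable
      (fun n => (2 : ℝ) ^ (-((a n : ℤ) ^ 2)) * |readPairing (u n) (a n) x|) := by
    intro x
    refine Summable.of_nonneg_of_le (fun n => by positivity) (fun n => ?_)
      (summable_geometric_two.mul_right ‖x‖)
    calc (2 : ℝ) ^ (-((a n : ℤ) ^ 2)) * |readPairing (u n) (a n) x|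
        ≤ (2 : ℝ) ^ (-((a n : ℤ) ^ 2)) * (((a n : ℝ) + 1) * ‖x‖) := by
          gcongr; exact hpair n x
      _ = ((2 : ℝ) ^ (-((a n : ℤ) ^ 2)) * ((a n : ℝ) + 1)) * ‖x‖ := by ring
      _ ≤ _ := mul_le_mul_of_nonneg_right (read_weight _ _ (hage n)) (norm_nonneg x)
  have hNge : ∀ x, ‖x‖ ≤ N x := fun x => by
    rw [hNeq]
    have : 0 ≤ ∑' n : ℕ, (2 : ℝ) ^ (-((a n : ℤ) ^ 2)) * |readPairing (u n) (a n) x| :=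
      tsum_nonneg (fun n => by positivity)
    linarith
  have hN0 : ∀ x, 0 ≤ N x := fun x => (norm_nonneg x).trans (hNge x)
  have hsm : ∀ (c : ℝ) x, 0 < c → N (c • x) = c * N x := by
    intro c x hc
    rw [hNeq, hNeq, norm_smul, Real.norm_of_nonneg hc.le, mul_add, ← tsum_mul_left]
    congr 1
    refine tsum_congr (fun n => ?_)
    rw [readPairing_smul, abs_mul, abs_of_pos hc]; ring
  have hNz : N 0 = 0 := by
    rw [hNeq]
    simp [readPairing]
  have hbdd : ∀ w : CZero ⧸ Y,
      BddBelow (N '' {x : CZero | (Submodule.Quotient.mk x : CZero ⧸ Y) = w}) := fun w =>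
    ⟨0, by rintro _ ⟨x, _, rfl⟩; exact hN0 x⟩
  have hqz : quotNormOf Y N 0 ≤ 0 := by
    unfold quotNormOf
    exact csInf_le (hbdd 0) ⟨0, by simp, hNz⟩
  have : IsClosed (Y : Set CZero) := hYc
  -- separation
  obtain ⟨g, hg1, hg2⟩ : ∃ g : (CZero ⧸ Y) →L[ℝ] ℝ, 0 < g w₁ ∧ g w₂ < 0 := by
    have h0 : (0 : CZero ⧸ Y) ∉ segment ℝ w₁ (-w₂) := by
      rintro ⟨s, t, hs, ht, hst, he⟩
      have he' : s • w₁ = t • w₂ := by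
        rw [smul_neg, ← sub_eq_add_neg, sub_eq_zero] at he; exact he
      rcases hs.eq_or_lt with rfl | hs
      · have : t = 1 := by linarith
        subst this
        rw [zero_smul, one_smul] at he'
        rw [← he'] at h₂; linarith
      rcases ht.eq_or_lt with rfl | ht
      · have : s = 1 := by linarith
        subst this
        rw [zero_smul, one_smul] at he'
        rw [he'] at h₁; linarith
      have := congrArg (quotNormOf Y N) he'
      rw [qn_smul Y N hsm s hs, qn_smul Y N hsm t ht, h₁, h₂, mul_one, mul_one] at this
      subst this
      exact hne (smul_right_injective _ hs.ne' he')
    have hcl : IsClosed (segment ℝ w₁ (-w₂)) := by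
      rw [← convexHull_pair (𝕜 := ℝ)]
      exact ((Set.toFinite {w₁, -w₂}).isCompact_convexHull ℝ).isClosed
    have : LocallyConvexSpace ℝ (CZero ⧸ Y) := NormedSpace.toLocallyConvexSpace (E := CZero ⧸ Y)
    obtain ⟨g, r, hg0, hg⟩ := geometric_hahn_banach_point_closed (convex_segment w₁ (-w₂)) hcl h0
    refine ⟨g, ?_, ?_⟩
    · have := hg _ (left_mem_segment ℝ w₁ (-w₂)); rw [map_zero] at hg0; linarith
    · have := hg _ (right_mem_segment ℝ w₁ (-w₂)); rw [map_zero] at hg0; rw [map_neg] at this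
      linarith
  obtain ⟨K, hK0, hK1, hK2⟩ : ∃ K : ℝ, 0 < K ∧ 5 ≤ K * g w₁ ∧ K * g w₂ ≤ -5 := by
    refine ⟨5 / g w₁ + 5 / (- g w₂), ?_, ?_, ?_⟩
    · have : 0 < - g w₂ := by linarith
      positivity
    · have h3 : 0 < 5 / (- g w₂) := by have : 0 < - g w₂ := by linarith
                                       positivity
      have h4 : 5 / g w₁ * g w₁ = 5 := div_mul_cancel₀ _ hg1.ne'
      nlinarith
    · have h3 : 0 < 5 / g w₁ := by positivity
      have h4 : 5 / (- g w₂) * (- g w₂) = 5 := div_mul_cancel₀ _ (by linarith)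
      nlinarith
  let π : CZero →L[ℝ] (CZero ⧸ Y) := ⟨Y.mkQ, continuous_quot_mk⟩
  obtain ⟨v, hv⟩ := cz_approx (K • (g.comp π))
  have hf : ∀ x, (K • (g.comp π)) x = K * g (Submodule.Quotient.mk x) := fun x => rfl
  obtain ⟨n, hn⟩ := (hu v).nonempty
  have hn : u n = v := hn
  set δ : ℝ := (2 : ℝ) ^ (-((a n : ℤ) ^ 2)) with hδ
  have hδ0 : 0 < δ := by positivity
  have key : ∀ x y : CZero, (Submodule.Quotient.mk x : CZero ⧸ Y) = w₁ →
      (Submodule.Quotient.mk y : CZero ⧸ Y) = w₂ → N x ≤ 2 → N y ≤ 2 →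
      N (x + y) ≤ N x + N y - 2 * δ := by
    intro x y hx hy hNx hNy
    have hx1 := hv x
    have hy1 := hv y
    rw [hf, hx] at hx1
    rw [hf, hy] at hy1
    have hx2 := (hNge x).trans hNx
    have hy2 := (hNge y).trans hNy
    have px : 1 ≤ readPairing (u n) (a n) x := by
      rw [hn]; unfold readPairing
      have := cz_abs_le x (a n)
      rw [abs_le] at this hx1
      linarith [this.1, this.2, hx1.1, hx1.2]
    have py : readPairing (u n) (a n) y ≤ -1 := by
      rw [hn]; unfold readPairing
      have := cz_abs_le y (a n)
      rw [abs_le] at this hy1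
      linarith [this.1, this.2, hy1.1, hy1.2]
    have hs := ((hsumm x).add (hsumm y)).sub (hsumm (x + y))
    have hle := hs.le_tsum n (fun m _ => by
      rw [readPairing_add]
      have := abs_add_le (readPairing (u m) (a m) x) (readPairing (u m) (a m) y)
      have hp : (0:ℝ) ≤ (2 : ℝ) ^ (-((a m : ℤ) ^ 2)) := by positivity
      nlinarith)
    rw [((hsumm x).add (hsumm y)).tsum_sub (hsumm (x + y)), (hsumm x).tsum_add (hsumm y),
      readPairing_add, ← hδ] at hle
    have hab : 2 ≤ |readPairing (u n) (a n) x| + |readPairing (u n) (a n) y|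
        - |readPairing (u n) (a n) x + readPairing (u n) (a n) y| := by
      rw [abs_of_pos (by linarith : 0 < readPairing (u n) (a n) x),
        abs_of_neg (by linarith : readPairing (u n) (a n) y < 0)]
      have : |readPairing (u n) (a n) x + readPairing (u n) (a n) y| ≤
        readPairing (u n) (a n) x - readPairing (u n) (a n) y - 2 := by
        rw [abs_le]; constructor <;> linarith
      linarith
    have := norm_add_le x y
    rw [hNeq x, hNeq y, hNeq (x + y)]
    nlinarith
  have hnon : ∀ w : CZero ⧸ Y,
      (N '' {x : CZero | (Submodule.Quotient.mk x : CZero ⧸ Y) = w}).Nonempty := fun w => by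
    obtain ⟨x, hx⟩ := Submodule.Quotient.mk_surjective Y w
    exact ⟨_, x, hx, rfl⟩
  have hη : 0 < min 1 (δ / 2) := lt_min one_pos (by positivity)
  obtain ⟨_, ⟨x, hx, rfl⟩, hxN⟩ := exists_lt_of_csInf_lt (hnon w₁)
    (show quotNormOf Y N w₁ < 1 + min 1 (δ / 2) by linarith)
  obtain ⟨_, ⟨y, hy, rfl⟩, hyN⟩ := exists_lt_of_csInf_lt (hnon w₂)
    (show quotNormOf Y N w₂ < 1 + min 1 (δ / 2) by linarith)
  have m1 := min_le_left 1 (δ / 2)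
  have m2 := min_le_right 1 (δ / 2)
  have hk := key x y hx hy (by linarith) (by linarith)
  have hfin : quotNormOf Y N (w₁ + w₂) ≤ N (x + y) := by
    unfold quotNormOf
    refine csInf_le (hbdd _) ⟨x + y, ?_, rfl⟩
    rw [Set.mem_ofPred_eq] at hx hy ⊢
    rw [Submodule.Quotient.mk_add, hx, hy]
  linarith
end

section
/- Let X = (c₀, |‖·‖|) be Read's space. Then the set NA(X) of norm-attaining functionals on X contains no linear subspace of dimension greater than one; that is, there do not exist two linearly independent functionals f, g ∈ X* such that every linear combination of f and g attains its norm. -/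
open Filter Topology

namespace ReadAux

/-- unit vector -/
noncomputable def ee (k : ℕ) : CZero where
  toFun := fun j => if j = k then 1 else 0
  continuous_toFun := continuous_of_discreteTopology
  zero_at_infty' := by
    rw [Filter.cocompact_eq_cofinite]
    apply tendsto_const_nhds.congr'
    have : ({k} : Set ℕ)ᶜ ∈ Filter.cofinite := (Set.finite_singleton k).compl_mem_cofinite
    filter_upwards [this] with j hj
    have : j ≠ k := hj
    simp [this]

lemma ee_apply (k j : ℕ) : ee k j = if j = k then 1 else 0 := rfl

lemma abs_le_norm (x : CZero) (j : ℕ) : |x j| ≤ ‖x‖ := by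
  rw [← ZeroAtInftyContinuousMap.norm_toBCF_eq_norm]
  exact x.toBCF.norm_coe_le_norm j

lemma norm_le_of (x : CZero) {C : ℝ} (hC : 0 ≤ C) (h : ∀ j, |x j| ≤ C) : ‖x‖ ≤ C := by
  rw [← ZeroAtInftyContinuousMap.norm_toBCF_eq_norm]
  exact (BoundedContinuousFunction.norm_le hC).2 h

lemma tendsto_zero (x : CZero) : Tendsto (fun j => x j) atTop (𝓝 0) := by
  have := x.zero_at_infty'
  rwa [Filter.cocompact_eq_cofinite, Nat.cofinite_eq_atTop] at this

/-- pairing -/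
noncomputable def PP (v : ℕ →₀ ℚ) (x : CZero) : ℝ := ∑ j ∈ v.support, (v j : ℝ) * x j

lemma PP_eq_sum (v : ℕ →₀ ℚ) (x : CZero) : PP v x = v.sum (fun j c => (c : ℝ) * x j) := rfl

lemma PP_add (v w : ℕ →₀ ℚ) (x : CZero) : PP (v + w) x = PP v x + PP w x := by
  simp only [PP_eq_sum]
  apply Finsupp.sum_add_index'
  · intro; simp
  · intro j b c; push_cast; ring

lemma PP_single (k : ℕ) (c : ℚ) (x : CZero) : PP (Finsupp.single k c) x = c * x k := by
  simp only [PP_eq_sum]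
  rw [Finsupp.sum_single_index]; simp

lemma readPairing_add (v : ℕ →₀ ℚ) (k : ℕ) (x y : CZero) :
    readPairing v k (x + y) = readPairing v k x + readPairing v k y := by
  simp only [readPairing, ZeroAtInftyContinuousMap.add_apply, mul_add, Finset.sum_add_distrib]
  ring

lemma readPairing_smul (v : ℕ →₀ ℚ) (k : ℕ) (c : ℝ) (x : CZero) :
    readPairing v k (c • x) = c * readPairing v k x := by
  simp only [readPairing, ZeroAtInftyContinuousMap.smul_apply, smul_eq_mul, mul_sub,
    Finset.mul_sum]
  congr 1
  apply Finset.sum_congr rfl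
  intros; ring

lemma readPairing_ee (v : ℕ →₀ ℚ) (k l : ℕ) :
    readPairing v k (ee l) = v l - if k = l then 1 else 0 := by
  simp only [readPairing, ee_apply, mul_ite, mul_one, mul_zero, Finset.sum_ite_eq']
  congr 1
  split_ifs with h
  · rfl
  · simp at h; simp [h]

lemma readPairing_bound (v : ℕ →₀ ℚ) (k : ℕ) (hv : ∑ j ∈ v.support, |(v j : ℝ)| ≤ (k : ℝ))
    (x : CZero) : |readPairing v k x| ≤ (k + 1) * ‖x‖ := by
  have h1 : |∑ j ∈ v.support, (v j : ℝ) * x j| ≤ k * ‖x‖ := by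
    calc _ ≤ ∑ j ∈ v.support, |(v j : ℝ) * x j| := Finset.abs_sum_le_sum_abs _ _
      _ ≤ ∑ j ∈ v.support, |(v j : ℝ)| * ‖x‖ := by
          apply Finset.sum_le_sum
          intro j _
          rw [abs_mul]
          exact mul_le_mul_of_nonneg_left (abs_le_norm x j) (abs_nonneg _)
      _ = (∑ j ∈ v.support, |(v j : ℝ)|) * ‖x‖ := by rw [Finset.sum_mul]
      _ ≤ _ := mul_le_mul_of_nonneg_right hv (norm_nonneg _)
  have h2 := abs_le_norm x k
  have h3 := abs_sub (∑ j ∈ v.support, (v j : ℝ) * x j) (x k)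
  unfold readPairing
  linarith

lemma zpow_eq (k : ℕ) : (2 : ℝ) ^ (-((k : ℤ) ^ 2)) = (1/2 : ℝ) ^ (k ^ 2) := by
  rw [zpow_neg, one_div, inv_pow]
  norm_cast

lemma weight_bound (k : ℕ) (m : ℕ) (h : m + k ≤ k ^ 2) :
    (1/2 : ℝ) ^ (k ^ 2) * (k + 1) ≤ (1/2 : ℝ) ^ m := by
  have h1 : (k : ℝ) + 1 ≤ 2 ^ k := by
    exact_mod_cast Nat.lt_two_pow_self (n := k)
  calc (1/2 : ℝ) ^ (k ^ 2) * (k + 1) ≤ (1/2 : ℝ) ^ (m + k) * 2 ^ k := by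
        apply mul_le_mul _ h1 (by positivity) (by positivity)
        exact pow_le_pow_of_le_one (by norm_num) (by norm_num) h
    _ = (1/2 : ℝ) ^ m := by
        rw [pow_add, mul_assoc, ← mul_pow]; norm_num

section
variable (u : ℕ → (ℕ →₀ ℚ)) (a : ℕ → ℕ)

/-- terms -/
noncomputable def TT (x : CZero) (m : ℕ) : ℝ :=
  (1/2 : ℝ) ^ ((a m) ^ 2) * |readPairing (u m) (a m) x|

/-- norm -/
noncomputable def NN (x : CZero) : ℝ := ‖x‖ + ∑' m, TT u a x m

variable {u a}

lemma TT_nonneg (x : CZero) (m : ℕ) : 0 ≤ TT u a x m := by unfold TT; positivity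

lemma a_ge (ha : StrictMono a) (hpos : ∀ n, 0 < a n) (n : ℕ) : n + 1 ≤ a n := by
  induction n with
  | zero => exact hpos 0
  | succ k ih => have := ha (Nat.lt_add_one k); omega

lemma TT_summable (ha : StrictMono a) (hpos : ∀ n, 0 < a n)
    (hn : ∀ n, (∑ j ∈ (u n).support, |((u n) j : ℝ)|) ≤ (a n : ℝ)) (x : CZero) :
    Summable (TT u a x) := by
  apply Summable.of_nonneg_of_le (TT_nonneg x) (f := fun m => (1/2 : ℝ) ^ m * ‖x‖)
  · intro m
    unfold TT
    have h1 := readPairing_bound _ _ (hn m) x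
    have h2 := weight_bound (a m) m (by have := a_ge ha hpos m; nlinarith)
    calc _ ≤ (1/2 : ℝ) ^ ((a m) ^ 2) * ((a m + 1) * ‖x‖) :=
          mul_le_mul_of_nonneg_left h1 (by positivity)
      _ = ((1/2 : ℝ) ^ ((a m) ^ 2) * (a m + 1)) * ‖x‖ := by ring
      _ ≤ _ := mul_le_mul_of_nonneg_right h2 (norm_nonneg _)
  · exact (summable_geometric_of_lt_one (by norm_num) (by norm_num)).mul_right _

lemma NN_ge (x : CZero) : ‖x‖ ≤ NN u a x := by
  unfold NN
  have : 0 ≤ ∑' m, TT u a x m := tsum_nonneg (TT_nonneg (u := u) (a := a) x)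
  linarith

lemma NN_smul (c : ℝ) (x : CZero) : NN u a (c • x) = |c| * NN u a x := by
  unfold NN
  rw [norm_smul, mul_add, ← tsum_mul_left, Real.norm_eq_abs]
  congr 2
  ext m
  simp only [TT, readPairing_smul, abs_mul]
  ring

/-- The key increment estimate. -/
lemma NN_incr (ha : StrictMono a) (hpos : ∀ n, 0 < a n)
    (hs : ∀ n, ∀ j ∈ (u n).support, j < a n)
    (hn : ∀ n, (∑ j ∈ (u n).support, |((u n) j : ℝ)|) ≤ (a n : ℝ)) (x : CZero)
    (n : ℕ) (t σ : ℝ) (hσ : σ = 1 ∨ σ = -1) (h1 : |x (a n)| + |t| ≤ ‖x‖)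
    (h2 : |t| ≤ σ * readPairing (u n) (a n) x) :
    NN u a (x + t • ee (a n)) - NN u a x ≤
      (1/2 : ℝ) ^ ((a n) ^ 2) * (- σ * t + 2 * |t| * (1/2 : ℝ) ^ (a n)) := by
  have hnorm : ‖x + t • ee (a n)‖ ≤ ‖x‖ := by
    apply norm_le_of _ (norm_nonneg _)
    intro j
    simp only [ZeroAtInftyContinuousMap.add_apply, ZeroAtInftyContinuousMap.smul_apply, ee_apply,
      smul_eq_mul]
    split_ifs with h
    · subst h
      have := abs_add_le (x (a n)) (t * 1)
      rw [mul_one] at *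
      linarith
    · simpa using abs_le_norm x j
  have u0 : ∀ m l, a m ≤ l → (u m) l = 0 := by
    intro m l h
    by_contra h'
    have := hs m l (by simpa using h')
    omega
  have hS1 := TT_summable ha hpos hn (x + t • ee (a n))
  have hS2 := TT_summable ha hpos hn x
  have hS := hS1.sub hS2
  have hlow : ∀ m ∈ Finset.range n, TT u a (x + t • ee (a n)) m - TT u a x m = 0 := by
    intro m hm
    have hm' := ha (Finset.mem_range.1 hm)
    simp only [TT, readPairing_add, readPairing_smul, readPairing_ee, u0 m (a n) hm'.le,
      if_neg hm'.ne]
    simp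
  have hmid : TT u a (x + t • ee (a n)) n - TT u a x n = (1/2 : ℝ) ^ ((a n) ^ 2) * (- σ * t) := by
    simp only [TT, readPairing_add, readPairing_smul, readPairing_ee, u0 n (a n) le_rfl,
      if_true]
    rw [← mul_sub]
    congr 1
    push_cast
    have := le_abs_self t
    have := neg_abs_le t
    have := abs_nonneg t
    rcases hσ with rfl | rfl
    · rw [abs_of_nonneg (by linarith), abs_of_nonneg (by linarith)]; ring
    · rw [abs_of_nonpos (by linarith), abs_of_nonpos (by linarith)]; ring
  have hhigh : ∀ i, TT u a (x + t • ee (a n)) (i + (n + 1)) - TT u a x (i + (n + 1)) ≤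
      ((1/2 : ℝ) ^ ((a n) ^ 2) * |t| * (1/2 : ℝ) ^ (a n)) * (1/2 : ℝ) ^ i := by
    intro i
    set m := i + (n + 1) with hm
    have ham : a n + 1 + i ≤ a m := by
      have := ha.add_le_nat i (n+1)
      have h3 := ha (Nat.lt_add_one n)
      rw [hm]
      omega
    have hne : a m ≠ a n := by omega
    simp only [TT, readPairing_add, readPairing_smul, readPairing_ee, if_neg hne, sub_zero]
    rw [← mul_sub]
    have hb : |((u m) (a n) : ℝ)| ≤ a m := by
      by_cases h0 : (u m) (a n) = 0
      · simp [h0]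
      · refine le_trans ?_ (hn m)
        exact Finset.single_le_sum (f := fun j => |((u m) j : ℝ)|) (fun _ _ => abs_nonneg _)
          (by simpa using h0)
    have h4 : |readPairing (u m) (a m) x + t * ((u m) (a n) : ℝ)| - |readPairing (u m) (a m) x|
        ≤ |t| * (a m + 1) := by
      have := abs_add_le (readPairing (u m) (a m) x) (t * ((u m) (a n) : ℝ))
      rw [abs_mul] at this
      have := mul_le_mul_of_nonneg_left hb (abs_nonneg t)
      have := abs_nonneg t
      linarith
    have h5 := weight_bound (a m) ((a n)^2 + a n + i) (by nlinarith)
    calc _ ≤ (1/2 : ℝ) ^ ((a m) ^ 2) * (|t| * (a m + 1)) :=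
          mul_le_mul_of_nonneg_left h4 (by positivity)
      _ = |t| * ((1/2 : ℝ) ^ ((a m) ^ 2) * (a m + 1)) := by ring
      _ ≤ |t| * (1/2 : ℝ) ^ ((a n)^2 + a n + i) := mul_le_mul_of_nonneg_left h5 (abs_nonneg _)
      _ = _ := by rw [pow_add, pow_add]; ring
  have htail : ∑' i, (TT u a (x + t • ee (a n)) (i + (n + 1)) - TT u a x (i + (n + 1))) ≤
      ((1/2 : ℝ) ^ ((a n) ^ 2) * |t| * (1/2 : ℝ) ^ (a n)) * 2 := by
    have hg := tsum_mul_left (L := SummationFilter.unconditional ℕ) (a := ((1/2 : ℝ) ^ ((a n) ^ 2) * |t| * (1/2 : ℝ) ^ (a n)))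
      (f := fun i : ℕ => (1/2 : ℝ) ^ i)
    rw [tsum_geometric_two] at hg
    rw [← hg]
    apply Summable.tsum_le_tsum hhigh
    · exact (summable_nat_add_iff (n+1)).2 hS
    · exact (summable_geometric_of_lt_one (by norm_num) (by norm_num)).mul_left _
  have hsplit := hS.sum_add_tsum_nat_add (n+1)
  rw [Finset.sum_range_succ, Finset.sum_eq_zero hlow, hmid, hS1.tsum_sub hS2] at hsplit
  unfold NN
  linarith

lemma le_M {h : CZero →L[ℝ] ℝ} {x : CZero}
    (hx : h x = sSup ((fun z => h z) '' {z : CZero | NN u a z ≤ 1})) (z : CZero) :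
    h z ≤ h x * NN u a z := by
  have hb : BddAbove ((fun z => h z) '' {z : CZero | NN u a z ≤ 1}) := by
    refine ⟨‖h‖, ?_⟩
    rintro _ ⟨z, hz, rfl⟩
    have h1 := h.le_opNorm z
    have h2 : ‖z‖ ≤ 1 := (NN_ge z).trans hz
    have h3 := le_abs_self (h z)
    rw [Real.norm_eq_abs] at h1
    have := mul_le_mul_of_nonneg_left h2 (norm_nonneg h)
    simp only
    linarith
  by_cases hz : z = 0
  · have : NN u a (0:CZero) = 0 := by
      have := NN_smul (u := u) (a := a) 0 0
      simpa using this
    simp [hz, this]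
  have hp : 0 < NN u a z := (norm_pos_iff.2 hz).trans_le (NN_ge z)
  have : h ((NN u a z)⁻¹ • z) ≤ h x := by
    rw [hx]
    apply le_csSup hb
    refine ⟨_, ?_, rfl⟩
    simp only [Set.mem_ofPred_eq, NN_smul]
    rw [abs_of_pos (inv_pos.2 hp), inv_mul_cancel₀ hp.ne']
  rw [map_smul, smul_eq_mul, inv_mul_le_iff₀ hp] at this
  linarith

lemma M_pos {h : CZero →L[ℝ] ℝ} (h0 : h ≠ 0) {x : CZero}
    (hx : ∀ z, h z ≤ h x * NN u a z) : 0 < h x := by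
  obtain ⟨z, hz⟩ : ∃ z, h z ≠ 0 := by
    by_contra! hc
    exact h0 (ContinuousLinearMap.ext hc)
  have key : ∀ z, 0 < h z → 0 < h x := by
    intro z hz
    have h1 := hx z
    have h2 : 0 ≤ NN u a z := (norm_nonneg z).trans (NN_ge z)
    by_contra! hc
    nlinarith
  rcases lt_or_gt_of_ne hz with h1 | h1
  · exact key (-z) (by simpa using h1)
  · exact key z h1

lemma key (ha : StrictMono a) (hpos : ∀ n, 0 < a n)
    (hs : ∀ n, ∀ j ∈ (u n).support, j < a n)
    (hn : ∀ n, (∑ j ∈ (u n).support, |((u n) j : ℝ)|) ≤ (a n : ℝ))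
    (h : CZero →L[ℝ] ℝ) (x : CZero) (hxpos : 0 < h x) (hx1 : NN u a x ≤ 1)
    (hx : ∀ z, h z ≤ h x * NN u a z) (v : ℕ →₀ ℚ) (σ : ℝ) (hσ : σ = 1 ∨ σ = -1)
    (hv : 0 < σ * PP v x) (ε : ℝ) (hε : 0 < ε) :
    ∀ᶠ n in atTop, u n = v → |2 ^ ((a n) ^ 2) * h (ee (a n)) + h x * σ| ≤ ε := by
  have hx0 : x ≠ 0 := by rintro rfl; simp at hxpos
  have hxn : 0 < ‖x‖ := norm_pos_iff.2 hx0
  have T1 : Tendsto (fun n => |x (a n)|) atTop (𝓝 0) := by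
    have := ((tendsto_zero x).comp ha.tendsto_atTop).abs
    simpa using this
  have T2 : Tendsto (fun n => h x * 2 * (1/2 : ℝ) ^ (a n)) atTop (𝓝 0) := by
    have := ((tendsto_pow_atTop_nhds_zero_of_lt_one (r := (1/2 : ℝ)) (by norm_num)
      (by norm_num)).comp ha.tendsto_atTop).const_mul (h x * 2)
    simpa using this
  set s := min (‖x‖ / 2) (σ * PP v x / 2) with hsd
  have hs0 : 0 < s := by positivity
  have hs1 : s ≤ ‖x‖ / 2 := min_le_left _ _
  have hs2 : s ≤ σ * PP v x / 2 := min_le_right _ _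
  filter_upwards [T1.eventually (gt_mem_nhds hs0), T2.eventually (gt_mem_nhds hε)] with n e1 e2 hu
  have hrp : readPairing (u n) (a n) x = PP v x - x (a n) := by rw [hu]; rfl
  have hA : s ≤ σ * readPairing (u n) (a n) x := by
    rw [hrp]
    have := abs_lt.1 e1
    rcases hσ with rfl | rfl <;> linarith
  have core : ∀ t, |t| = s → t * h (ee (a n)) ≤
      h x * ((1/2 : ℝ) ^ ((a n) ^ 2) * (- σ * t + 2 * s * (1/2 : ℝ) ^ (a n))) := by
    intro t ht
    have h1 := NN_incr ha hpos hs hn x n t σ hσ (by rw [ht]; linarith) (by rw [ht]; exact hA)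
    have h2 := hx (x + t • ee (a n))
    rw [map_add, map_smul, smul_eq_mul] at h2
    rw [ht] at h1
    have h3 : NN u a (x + t • ee (a n)) ≤ 1 +
      (1/2 : ℝ) ^ ((a n) ^ 2) * (- σ * t + 2 * s * (1/2 : ℝ) ^ (a n)) := by linarith
    have := mul_le_mul_of_nonneg_left h3 hxpos.le
    linarith
  have c1 := core s (abs_of_pos hs0)
  have c2 := core (-s) (by rw [abs_neg, abs_of_pos hs0])
  set H := h (ee (a n))
  set q := (1/2 : ℝ) ^ (a n)
  have hW : (2:ℝ) ^ ((a n) ^ 2) * (1/2 : ℝ) ^ ((a n) ^ 2) = 1 := by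
    rw [← mul_pow]; norm_num
  set W := (1/2 : ℝ) ^ ((a n) ^ 2)
  set V := (2:ℝ) ^ ((a n) ^ 2)
  have hV : 0 < V := by positivity
  have d1 : H ≤ h x * (W * (-σ + 2 * q)) := by
    apply le_of_mul_le_mul_left _ hs0
    linarith
  have d2 : -H ≤ h x * (W * (σ + 2 * q)) := by
    apply le_of_mul_le_mul_left _ hs0
    linarith
  have d1' := mul_le_mul_of_nonneg_left d1 hV.le
  have d2' := mul_le_mul_of_nonneg_left d2 hV.le
  have r1 : V * (h x * (W * (-σ + 2 * q))) = h x * (-σ + 2 * q) := by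
    linear_combination (h x * (-σ + 2 * q)) * hW
  have r2 : V * (h x * (W * (σ + 2 * q))) = h x * (σ + 2 * q) := by
    linear_combination (h x * (σ + 2 * q)) * hW
  rw [r1] at d1'
  rw [r2] at d2'
  rw [abs_le]
  constructor <;> linarith

end

lemma exists_rat (A B C D : ℝ) (hdet : A * D - B * C ≠ 0) (σ τ : ℝ) (hσ : σ = 1 ∨ σ = -1)
    (hτ : τ = 1 ∨ τ = -1) :
    ∃ p q : ℚ, 0 < σ * (p * A + q * B) ∧ 0 < τ * (p * C + q * D) := by
  have hd : DenseRange (Prod.map ((↑) : ℚ → ℝ) ((↑) : ℚ → ℝ)) :=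
    Rat.denseRange_cast.prodMap Rat.denseRange_cast
  have ho : IsOpen {z : ℝ × ℝ | 0 < σ * (z.1 * A + z.2 * B) ∧ 0 < τ * (z.1 * C + z.2 * D)} := by
    exact (isOpen_lt (f := fun _ : ℝ × ℝ => (0:ℝ))
      (g := fun z : ℝ × ℝ => σ * (z.1 * A + z.2 * B)) (by fun_prop) (by fun_prop)).inter
      (isOpen_lt (f := fun _ : ℝ × ℝ => (0:ℝ))
      (g := fun z : ℝ × ℝ => τ * (z.1 * C + z.2 * D)) (by fun_prop) (by fun_prop))
  obtain ⟨⟨p, q⟩, hpq⟩ := hd.exists_mem_open ho (by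
    refine ⟨((σ * D - τ * B) / (A * D - B * C), (τ * A - σ * C) / (A * D - B * C)), ?_⟩
    have e1 : (σ * D - τ * B) / (A * D - B * C) * A + (τ * A - σ * C) / (A * D - B * C) * B = σ := by
      rw [div_mul_eq_mul_div, div_mul_eq_mul_div, ← add_div, div_eq_iff hdet]; ring
    have e2 : (σ * D - τ * B) / (A * D - B * C) * C + (τ * A - σ * C) / (A * D - B * C) * D = τ := by
      rw [div_mul_eq_mul_div, div_mul_eq_mul_div, ← add_div, div_eq_iff hdet]; ring
    simp only [Set.mem_ofPred_eq, e1, e2]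
    constructor
    · rcases hσ with rfl | rfl <;> norm_num
    · rcases hτ with rfl | rfl <;> norm_num)
  exact ⟨p, q, hpq⟩

lemma exists_v (x y w : CZero) (hw : w ≠ 0) (i j : ℕ) (hdet : x i * y j - x j * y i ≠ 0)
    (σ τ : ℝ) (hσ : σ = 1 ∨ σ = -1) (hτ : τ = 1 ∨ τ = -1) :
    ∃ v : ℕ →₀ ℚ, 0 < σ * PP v x ∧ 0 < τ * PP v y ∧ PP v w ≠ 0 := by
  obtain ⟨p, q, h1, h2⟩ := exists_rat _ _ _ _ hdet σ τ hσ hτ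
  set v0 : ℕ →₀ ℚ := Finsupp.single i p + Finsupp.single j q with hv0
  have e : ∀ z, PP v0 z = p * z i + q * z j := by
    intro z; rw [hv0, PP_add, PP_single, PP_single]
  rw [← e] at h1 h2
  by_cases hz : PP v0 w = 0
  swap
  · exact ⟨v0, h1, h2, hz⟩
  obtain ⟨k, hk⟩ : ∃ k, w k ≠ 0 := by
    by_contra! hc
    exact hw (by ext l; simpa using hc l)
  have lim : ∀ (c b d : ℝ), 0 < c * b → ∀ᶠ n : ℕ in atTop,
      0 < c * (b + 1 / ((n:ℝ) + 1) * d) := by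
    intro c b d hcb
    have : Tendsto (fun n : ℕ => c * (b + 1 / ((n:ℝ) + 1) * d)) atTop (𝓝 (c * (b + 0 * d))) :=
      ((tendsto_one_div_add_atTop_nhds_zero_nat.mul_const d).const_add b).const_mul c
    rw [zero_mul, add_zero] at this
    exact this.eventually (lt_mem_nhds hcb)
  obtain ⟨n, n1, n2⟩ := ((lim _ _ (x k) h1).and (lim _ _ (y k) h2)).exists
  refine ⟨v0 + Finsupp.single k (1 / ((n:ℚ) + 1)), ?_, ?_, ?_⟩
  · rw [PP_add, PP_single]; push_cast; exact n1
  · rw [PP_add, PP_single]; push_cast; exact n2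
  · rw [PP_add, PP_single, hz, zero_add]
    apply mul_ne_zero _ hk
    have : (0:ℝ) < (n:ℝ) + 1 := by positivity
    push_cast
    positivity

lemma att {u : ℕ → (ℕ →₀ ℚ)} {a : ℕ → ℕ} (h : CZero →L[ℝ] ℝ) (h0 : h ≠ 0)
    (hh : AttainsWrt (NN u a) h) : ∃ x, NN u a x ≤ 1 ∧ 0 < h x ∧
      ∀ z, h z ≤ h x * NN u a z := by
  obtain ⟨x, hx1, hx⟩ := hh
  have hle := le_M hx
  exact ⟨x, hx1, M_pos h0 hle, hle⟩

lemma lin0 {W : Type*} [AddCommMonoid W] [Module ℝ W] (f g : W) (hfg : LinearIndependent ℝ ![f, g]) (c₁ c₂ : ℝ)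
    (h : c₁ ≠ 0 ∨ c₂ ≠ 0) : c₁ • f + c₂ • g ≠ 0 := by
  intro h0
  have := Fintype.linearIndependent_iffₛ.1 hfg ![c₁, c₂] 0 (by simpa using h0)
  have h1 := this 0
  have h2 := this 1
  simp at h1 h2
  tauto

lemma lin {V : Type*} [AddCommMonoid V] [Module ℝ V] [TopologicalSpace V] (f g : V →L[ℝ] ℝ) (hfg : LinearIndependent ℝ ![f, g]) (c₁ c₂ : ℝ)
    (h : c₁ ≠ 0 ∨ c₂ ≠ 0) : c₁ • f + c₂ • g ≠ 0 := lin0 f g hfg c₁ c₂ h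

lemma final {u : ℕ → (ℕ →₀ ℚ)} {a : ℕ → ℕ} (hinf : ∀ v : ℕ →₀ ℚ, {n : ℕ | u n = v}.Infinite)
    (ha : StrictMono a) (hpos : ∀ n, 0 < a n)
    (hs : ∀ n, ∀ j ∈ (u n).support, j < a n)
    (hn : ∀ n, (∑ j ∈ (u n).support, |((u n) j : ℝ)|) ≤ (a n : ℝ))
    (f k : CZero →L[ℝ] ℝ) (x y w : CZero) (hx1 : NN u a x ≤ 1) (hy1 : NN u a y ≤ 1)
    (hw1 : NN u a w ≤ 1) (hxp : 0 < f x) (hyp : 0 < k y) (hwp : 0 < (f + k) w)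
    (hx : ∀ z, f z ≤ f x * NN u a z) (hy : ∀ z, k z ≤ k y * NN u a z)
    (hw : ∀ z, (f + k) z ≤ (f + k) w * NN u a z) (hkx : k x = 0) : False := by
  have hdet : ∃ i j, x i * y j - x j * y i ≠ 0 := by
    by_contra! hc
    obtain ⟨i, hi⟩ : ∃ i, x i ≠ 0 := by
      by_contra! hc'
      have : x = 0 := by ext l; simpa using hc' l
      rw [this] at hxp; simp at hxp
    have : (x i) • y = (y i) • x := by
      ext j
      simp only [ZeroAtInftyContinuousMap.smul_apply, smul_eq_mul]
      linarith [hc i j]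
    have := congrArg k this
    rw [map_smul, map_smul, hkx, smul_zero, smul_eq_mul] at this
    rcases mul_eq_zero.1 this with h | h
    · exact hi h
    · exact hyp.ne' h
  obtain ⟨i, j, hij⟩ := hdet
  have hw0 : w ≠ 0 := by rintro rfl; simp at hwp
  have fin : ∀ σ τ : ℝ, (σ = 1 ∨ σ = -1) → (τ = 1 ∨ τ = -1) →
      ∃ ρ : ℝ, (ρ = 1 ∨ ρ = -1) ∧ (f + k) w * ρ = f x * σ + k y * τ := by
    intro σ τ hσ hτ
    obtain ⟨v, v1, v2, v3⟩ := exists_v x y w hw0 i j hij σ τ hσ hτ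
    obtain ⟨ρ, hρ, v3'⟩ : ∃ ρ : ℝ, (ρ = 1 ∨ ρ = -1) ∧ 0 < ρ * PP v w := by
      rcases lt_or_gt_of_ne v3 with h | h
      · exact ⟨-1, Or.inr rfl, by linarith⟩
      · exact ⟨1, Or.inl rfl, by linarith⟩
    refine ⟨ρ, hρ, ?_⟩
    rw [← sub_eq_zero, ← abs_eq_zero]
    apply le_antisymm _ (abs_nonneg _)
    apply le_of_forall_pos_le_add
    intro ε hε
    have k1 := key ha hpos hs hn f x hxp hx1 hx v σ hσ v1 (ε/3) (by positivity)
    have k2 := key ha hpos hs hn k y hyp hy1 hy v τ hτ v2 (ε/3) (by positivity)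
    have k3 := key ha hpos hs hn (f + k) w hwp hw1 hw v ρ hρ v3' (ε/3) (by positivity)
    obtain ⟨n, hnv, q1, q2, q3⟩ := ((Nat.frequently_atTop_iff_infinite.2 (hinf v)).and_eventually
      (k1.and (k2.and k3))).exists
    have q1 := abs_le.1 (q1 hnv)
    have q2 := abs_le.1 (q2 hnv)
    have q3 := abs_le.1 (q3 hnv)
    have e3 : (f + k) (ee (a n)) = f (ee (a n)) + k (ee (a n)) := rfl
    rw [e3] at q3
    rw [abs_le]
    constructor <;> linarith
  obtain ⟨ρ, hρ, r1⟩ := fin 1 1 (Or.inl rfl) (Or.inl rfl)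
  obtain ⟨ρ', hρ', r2⟩ := fin 1 (-1) (Or.inl rfl) (Or.inr rfl)
  rcases hρ with rfl | rfl <;> rcases hρ' with rfl | rfl <;> linarith

end ReadAux

open ReadAux in
/-- Let `X = (c₀, N)` be Read's space.  Then the set of norm-attaining
functionals on `X` contains no linear subspace of dimension greater than one: there do not
exist linearly independent `f, g ∈ X*` such that every linear combination of `f` and `g`
attains its norm (with respect to `N`). -/
theorem stmt18 (N : CZero → ℝ) (hN : IsReadNorm N) :
    ¬ ∃ f g : CZero →L[ℝ] ℝ, LinearIndependent ℝ ![f, g] ∧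
      ∀ c₁ c₂ : ℝ, AttainsWrt N (c₁ • f + c₂ • g) := by
  obtain ⟨u, a, hinf, ha, hpos, hs, hn, hNe⟩ := hN
  have hNN : N = NN u a := by
    funext x
    rw [hNe]
    simp only [NN, TT, zpow_eq]
  subst hNN
  rintro ⟨f, g, hfg, hatt⟩
  have hne : ∀ c₁ c₂ : ℝ, (c₁ ≠ 0 ∨ c₂ ≠ 0) → c₁ • f + c₂ • g ≠ 0 := by
    exact lin f g hfg
  have hmax : ∀ c₁ c₂ : ℝ, (c₁ ≠ 0 ∨ c₂ ≠ 0) → ∃ x, NN u a x ≤ 1 ∧ 0 < (c₁ • f + c₂ • g) x ∧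
      ∀ z, (c₁ • f + c₂ • g) z ≤ (c₁ • f + c₂ • g) x * NN u a z := by
    intro c₁ c₂ h
    exact att _ (hne _ _ h) (hatt c₁ c₂)
  obtain ⟨x, hx1, hxp, hx⟩ := hmax 1 0 (by simp)
  have e1 : (1:ℝ) • f + (0:ℝ) • g = f := by simp
  rw [e1] at hxp hx
  -- second functional, vanishing at `x`
  obtain ⟨y, hy1, hyp, hy⟩ := hmax (- g x) (f x) (Or.inr hxp.ne')
  obtain ⟨w, hw1, hwp, hw⟩ := hmax (1 - g x) (f x) (Or.inr hxp.ne')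
  obtain ⟨k, hk⟩ : ∃ k, k = (- g x) • f + (f x) • g := ⟨_, rfl⟩
  rw [← hk] at hyp hy
  have e2 : (1 - g x) • f + (f x) • g = f + k := by rw [hk]; module
  rw [e2] at hwp hw
  have hkx : k x = 0 := by simp [hk]; ring
  exact final hinf ha hpos hs hn f k x y w hx1 hy1 hw1 hxp hyp hwp hx hy hw hkx
end

section
/- For every finite-dimensional linear subspace Z of the dual space (ℓ₁)*, there exists an equivalent norm |‖·‖| on ℓ₁ such that no nonzero functional in Z attains its norm with respect to |‖·‖|; that is, Z ∖ {0} is disjoint from NA(ℓ₁, |‖·‖|). -/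
/-- `N` is a norm on `X` equivalent to the given norm `‖·‖`: it is subadditive, absolutely
homogeneous, and bounded above and below by positive multiples of `‖·‖`. -/
def IsEquivNorm {X : Type*} [SeminormedAddCommGroup X] [NormedSpace ℝ X] (N : X → ℝ) : Prop :=
  (∀ x y : X, N (x + y) ≤ N x + N y) ∧
  (∀ (c : ℝ) (x : X), N (c • x) = |c| * N x) ∧
  ∃ c C : ℝ, 0 < c ∧ ∀ x : X, c * ‖x‖ ≤ N x ∧ N x ≤ C * ‖x‖

abbrev X1 := lp (fun _ : ℕ => ℝ) 1

noncomputable def e1 (j : ℕ) : X1 := lp.single 1 j (1 : ℝ)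

lemma norm_e1 (j : ℕ) : ‖e1 j‖ = 1 := by
  unfold e1
  rw [lp.norm_single (by norm_num)]; simp

lemma hasSum_norm1 (x : X1) : HasSum (fun j => |x j|) ‖x‖ := by
  have := lp.hasSum_norm (p := 1) (by norm_num) x
  simpa using this

lemma hasSum_apply1 (g : X1 →L[ℝ] ℝ) (x : X1) : HasSum (fun j => x j * g (e1 j)) (g x) := by
  have h := (lp.hasSum_single (p := 1) (by norm_num) x).mapL g
  have h2 : ∀ j, lp.single 1 j (x j) = x j • e1 j := fun j => by
    rw [e1, ← lp.single_smul]; simp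
  simp only [h2, map_smul, smul_eq_mul] at h
  exact h

lemma ext1 (g : X1 →L[ℝ] ℝ) (h : ∀ j, g (e1 j) = 0) : g = 0 := by
  ext x
  have := hasSum_apply1 g x
  simp only [h, mul_zero] at this
  simpa using this.unique hasSum_zero

lemma lt1 (g : X1 →L[ℝ] ℝ) (s : ℝ) (h : ∀ j, |g (e1 j)| < s) (y : X1) (hy : ‖y‖ ≤ 1) :
    g y < s := by
  have hs : 0 < s := (abs_nonneg _).trans_lt (h 0)
  by_cases hy0 : y = 0
  · simpa [hy0] using hs
  obtain ⟨j, hj⟩ : ∃ j, y j ≠ 0 := by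
    by_contra! hc
    exact hy0 (lp.ext (funext hc))
  have h1 := hasSum_apply1 g y
  have h2 := (hasSum_norm1 y).mul_right s
  have : g y < ‖y‖ * s := by
    refine hasSum_lt (i := j) (fun k => ?_) ?_ h1 h2
    · refine (le_abs_self _).trans ?_
      rw [abs_mul]
      exact mul_le_mul_of_nonneg_left (h k).le (abs_nonneg _)
    · refine (le_abs_self _).trans_lt ?_
      rw [abs_mul]
      exact mul_lt_mul_of_pos_left (h j) (abs_pos.2 hj)
  nlinarith

lemma exists1 (b : ℕ → ℝ) (C : ℝ) (hb : ∀ j, |b j| ≤ C) :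
    ∃ q : X1 →L[ℝ] ℝ, ∀ j, q (e1 j) = b j := by
  have hs : ∀ x : X1, Summable (fun j => x j * b j) := fun x => by
    refine Summable.of_norm_bounded ((hasSum_norm1 x).summable.mul_right C) (fun j => ?_)
    rw [Real.norm_eq_abs, abs_mul]
    exact mul_le_mul_of_nonneg_left (hb j) (abs_nonneg _)
  let L : X1 →ₗ[ℝ] ℝ :=
    { toFun := fun x => ∑' j, x j * b j
      map_add' := fun x y => by
        rw [← (hs x).tsum_add (hs y)]
        congr 1; ext j; simp [add_mul]
      map_smul' := fun c x => by
        simp only [RingHom.id_apply, smul_eq_mul]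
        rw [← tsum_mul_left]
        congr 1; ext j; simp [mul_assoc] }
  refine ⟨L.mkContinuous C fun x => ?_, fun j => ?_⟩
  · rw [mul_comm]
    refine tsum_of_norm_bounded ((hasSum_norm1 x).mul_right C) (fun j => ?_)
    rw [Real.norm_eq_abs, abs_mul]
    exact mul_le_mul_of_nonneg_left (hb j) (abs_nonneg _)
  · change ∑' k, (e1 j) k * b k = b j
    rw [tsum_eq_single j]
    · simp [e1]
    · intro k hk
      simp [e1, hk]

/-- dual vectors of finite support -/
lemma dual1 {n : ℕ} (f : Fin n → (X1 →L[ℝ] ℝ)) (hf : LinearIndependent ℝ f) :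
    ∃ v : Fin n → (ℕ →₀ ℝ), ∀ i l,
      f i (Finsupp.linearCombination ℝ e1 (v l)) = if l = i then 1 else 0 := by
  let Q : (ℕ →₀ ℝ) →ₗ[ℝ] (Fin n → ℝ) :=
    LinearMap.pi fun i => (f i).toLinearMap ∘ₗ Finsupp.linearCombination ℝ e1
  have hQ : LinearMap.range Q = ⊤ := by
    by_contra hne
    obtain ⟨φ, hφ0, hφ⟩ := Submodule.exists_le_ker_of_lt_top _ (lt_top_iff_ne_top.2 hne)
    let c : Fin n → ℝ := fun i => φ (fun j => if i = j then 1 else 0)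
    have hz : ∑ i, c i • f i = 0 := by
      apply ext1
      intro j
      have h1 : φ (Q (Finsupp.single j 1)) = 0 := hφ ⟨_, rfl⟩
      rw [LinearMap.pi_apply_eq_sum_univ] at h1
      simp only [Q, LinearMap.pi_apply, LinearMap.comp_apply,
        Finsupp.linearCombination_single, one_smul] at h1
      simp only [ContinuousLinearMap.sum_apply, ContinuousLinearMap.smul_apply]
      rw [← h1]
      refine Finset.sum_congr rfl fun i _ => ?_
      simp [c, mul_comm]
    have hc := Fintype.linearIndependent_iff.1 hf c hz
    apply hφ0
    refine LinearMap.ext fun x => ?_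
    rw [LinearMap.pi_apply_eq_sum_univ]
    exact Finset.sum_eq_zero fun i _ => by rw [show φ _ = 0 from hc i, smul_zero]
  have hs := LinearMap.range_eq_top.1 hQ
  choose v hv using fun l : Fin n => hs (fun j => if l = j then 1 else 0)
  exact ⟨v, fun i l => congrFun (hv l) i⟩

lemma key1 {n : ℕ} (f q : Fin n → (X1 →L[ℝ] ℝ)) (M : ℕ) (K : ℝ) (hK : 0 < K)
    (hKf : ∑ i, ‖f i‖ ≤ K / 4)
    (hq : ∀ i j, q i (e1 j) = if j < M then f i (e1 j) else
      if j % n = i then K * (1 - 1 / ((j : ℝ) + 2)) else 0)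
    (c : Fin n → ℝ) (hc : c ≠ 0) (s : ℝ) (hs : ∀ j, |(∑ i, c i • q i) (e1 j)| ≤ s) (j : ℕ) :
    |(∑ i, c i • q i) (e1 j)| < s := by
  obtain ⟨i1, hi1⟩ := Function.ne_iff.1 hc
  have hn : 0 < n := i1.pos
  haveI : Nonempty (Fin n) := ⟨i1⟩
  obtain ⟨i0, hi0⟩ := Finite.exists_max (fun i => |c i|)
  have hm : 0 < |c i0| := (abs_pos.2 hi1).trans_le (hi0 i1)
  have tail : ∀ j, M ≤ j → ∀ i : Fin n, j % n = i →
      |(∑ i, c i • q i) (e1 j)| = |c i| * (K * (1 - 1 / ((j : ℝ) + 2))) := by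
    intro j hj i hji
    have : (∑ i, c i • q i) (e1 j) = c i * (K * (1 - 1 / ((j : ℝ) + 2))) := by
      simp only [ContinuousLinearMap.sum_apply, ContinuousLinearMap.smul_apply, smul_eq_mul]
      rw [Finset.sum_eq_single i]
      · rw [hq, if_neg (by omega), if_pos hji]
      · intro l _ hl
        rw [hq, if_neg (by omega), if_neg, mul_zero]
        intro h
        exact hl (Fin.ext (h.symm.trans hji))
      · simp
    rw [this, abs_mul, abs_of_nonneg (a := K * _)]
    have : 1 / ((j : ℝ) + 2) ≤ 1 := by
      rw [div_le_one (by positivity)]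
      have : (0 : ℝ) ≤ j := Nat.cast_nonneg j
      linarith
    exact mul_nonneg hK.le (by linarith)
  have big : ∀ k : ℕ, |c i0| * (K * (1 - 1 / ((k : ℝ) + 2))) < s := by
    intro k
    let t := n * (k + M + 1) + i0
    have hle : k + M + 1 ≤ n * (k + M + 1) := Nat.le_mul_of_pos_left _ hn
    have ht : k + M + 1 ≤ t := by omega
    have h1 := hs t
    rw [tail t (by omega) i0 (by simp [t, Nat.mul_add_mod, Nat.mod_eq_of_lt i0.2])] at h1
    refine lt_of_lt_of_le ?_ h1
    have hkt : (k : ℝ) + 2 < (t : ℝ) + 2 := by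
      have : (k : ℝ) < t := by exact_mod_cast (by omega : k < t)
      linarith
    have : 1 / ((t : ℝ) + 2) < 1 / ((k : ℝ) + 2) := one_div_lt_one_div_of_lt (by positivity) hkt
    gcongr
  by_cases hj : j < M
  · have h0 := big 0
    have : |(∑ i, c i • q i) (e1 j)| ≤ |c i0| * (K / 4) := by
      simp only [ContinuousLinearMap.sum_apply, ContinuousLinearMap.smul_apply, smul_eq_mul]
      calc |∑ i, c i * q i (e1 j)| ≤ ∑ i, |c i * q i (e1 j)| := Finset.abs_sum_le_sum_abs _ _
        _ ≤ ∑ i, |c i0| * ‖f i‖ := by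
          refine Finset.sum_le_sum fun i _ => ?_
          rw [abs_mul, hq, if_pos hj]
          have := (f i).le_opNorm (e1 j)
          rw [norm_e1, mul_one, Real.norm_eq_abs] at this
          exact mul_le_mul (hi0 i) this (abs_nonneg _) (abs_nonneg _)
        _ = |c i0| * ∑ i, ‖f i‖ := by rw [Finset.mul_sum]
        _ ≤ _ := by gcongr
    have hp : 0 < |c i0| * K := by positivity
    norm_num at h0
    nlinarith
  · let i : Fin n := ⟨j % n, Nat.mod_lt _ hn⟩
    rw [tail j (by omega) i rfl]
    refine lt_of_le_of_lt ?_ (big j)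
    have : 1 / ((j : ℝ) + 2) ≤ 1 := by
      rw [div_le_one (by positivity)]
      have : (0 : ℝ) ≤ j := Nat.cast_nonneg j
      linarith
    exact mul_le_mul_of_nonneg_right (hi0 i) (mul_nonneg hK.le (by linarith))

lemma basis1 {V : Type*} [AddCommGroup V] [Module ℝ V] (Z : Submodule ℝ V)
    [FiniteDimensional ℝ Z] : ∃ (n : ℕ) (f : Fin n → V), LinearIndependent ℝ f ∧
      ∀ g ∈ Z, ∃ c : Fin n → ℝ, g = ∑ i, c i • f i := by
  let B := Module.finBasis ℝ Z
  refine ⟨_, fun i => (B i : V),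
    B.linearIndependent.map' Z.subtype (Submodule.ker_subtype Z), fun g hg => ?_⟩
  refine ⟨fun i => B.repr ⟨g, hg⟩ i, ?_⟩
  have := congrArg Z.subtype (B.sum_repr ⟨g, hg⟩)
  rw [map_sum] at this
  simpa using this.symm

theorem stmt19 (Z : Submodule ℝ ((lp (fun _ : ℕ => ℝ) 1) →L[ℝ] ℝ))
    [FiniteDimensional ℝ Z] :
    ∃ N : lp (fun _ : ℕ => ℝ) 1 → ℝ, IsEquivNorm N ∧
      ∀ f : (lp (fun _ : ℕ => ℝ) 1) →L[ℝ] ℝ, f ∈ Z → f ≠ 0 → ¬ AttainsWrt N f := by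
  obtain ⟨n, f, hf, hspan⟩ := basis1 (V := X1 →L[ℝ] ℝ) Z
  obtain ⟨v, hv⟩ := dual1 f hf
  let u : Fin n → X1 := fun l => Finsupp.linearCombination ℝ e1 (v l)
  obtain ⟨M, hM⟩ : ∃ M : ℕ, ∀ l, ∀ j ∈ (v l).support, j < M := by
    refine ⟨(Finset.univ.biUnion fun l => (v l).support).sup id + 1, fun l j hj => ?_⟩
    have : j ∈ Finset.univ.biUnion fun l => (v l).support :=
      Finset.mem_biUnion.2 ⟨l, Finset.mem_univ _, hj⟩
    exact Nat.lt_succ_of_le (Finset.le_sup (f := id) this)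
  let K : ℝ := 4 * (∑ i, ‖f i‖ + 1)
  have hsum : 0 ≤ ∑ i, ‖f i‖ := Finset.sum_nonneg fun i _ => norm_nonneg _
  have hK : 0 < K := by positivity
  have hqe : ∀ i : Fin n, ∃ q : X1 →L[ℝ] ℝ, ∀ j, q (e1 j) = if j < M then f i (e1 j) else
      if j % n = i then K * (1 - 1 / ((j : ℝ) + 2)) else 0 := by
    intro i
    refine exists1 _ (‖f i‖ + K) fun j => ?_
    have hfi := norm_nonneg (f i)
    split_ifs
    · have := (f i).le_opNorm (e1 j)
      rw [norm_e1, mul_one, Real.norm_eq_abs] at this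
      linarith
    · have h1 : 1 / ((j : ℝ) + 2) ≤ 1 := by
        rw [div_le_one (by positivity)]
        have : (0 : ℝ) ≤ j := Nat.cast_nonneg j
        linarith
      have h2 : 0 ≤ 1 / ((j : ℝ) + 2) := by positivity
      rw [abs_of_nonneg (mul_nonneg hK.le (by linarith))]
      nlinarith
    · rw [abs_zero]; linarith
  choose q hq using hqe
  have hqu : ∀ i l, (q i - f i) (u l) = 0 := by
    intro i l
    simp only [u, Finsupp.linearCombination_apply, Finsupp.sum, map_sum, map_smul]
    refine Finset.sum_eq_zero fun j hj => ?_
    rw [ContinuousLinearMap.sub_apply, hq, if_pos (hM l j hj), sub_self, smul_zero]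
  let R : X1 →L[ℝ] X1 := ∑ i, (q i - f i).smulRight (u i)
  have hR : ∀ x, R x = ∑ i, (q i - f i) x • u i := fun x => by
    simp only [R, ContinuousLinearMap.sum_apply, ContinuousLinearMap.smulRight_apply]
  have hRR : ∀ x, R (R x) = 0 := by
    intro x
    rw [hR (R x)]
    refine Finset.sum_eq_zero fun i _ => ?_
    rw [hR x, map_sum]
    simp only [map_smul, hqu, smul_zero, Finset.sum_const_zero, zero_smul]
  have hfR : ∀ i x, f i (x + R x) = q i x := by
    intro i x
    rw [map_add, hR x, map_sum]
    simp only [map_smul, u, hv, smul_eq_mul, mul_ite, mul_one, mul_zero]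
    simp
  refine ⟨fun x => ‖x - R x‖, ⟨fun x y => ?_, fun a x => ?_, ?_⟩, ?_⟩
  · refine le_trans (le_of_eq ?_) (norm_add_le _ _)
    beta_reduce
    rw [map_add]; congr 1; abel
  · beta_reduce
    rw [map_smul, ← smul_sub, norm_smul, Real.norm_eq_abs]
  · have hp : 0 < 1 + ‖R‖ := by positivity
    refine ⟨(1 + ‖R‖)⁻¹, 1 + ‖R‖, by positivity, fun x => ⟨?_, ?_⟩⟩
    · rw [inv_mul_le_iff₀ hp]
      have h1 : x = (x - R x) + R (x - R x) := by rw [map_sub, hRR]; abel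
      calc ‖x‖ = ‖(x - R x) + R (x - R x)‖ := by rw [← h1]
        _ ≤ ‖x - R x‖ + ‖R (x - R x)‖ := norm_add_le _ _
        _ ≤ ‖x - R x‖ + ‖R‖ * ‖x - R x‖ := by gcongr; exact R.le_opNorm _
        _ = _ := by ring
    · calc ‖x - R x‖ ≤ ‖x‖ + ‖R x‖ := norm_sub_le _ _
        _ ≤ ‖x‖ + ‖R‖ * ‖x‖ := by gcongr; exact R.le_opNorm _
        _ = _ := by ring
  · rintro g hg hg0 ⟨x, hx, hgx⟩
    obtain ⟨c, hgc⟩ := hspan g hg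
    have hc : c ≠ 0 := by
      intro h
      apply hg0
      rw [hgc, h]; simp
    set p : X1 →L[ℝ] ℝ := ∑ i, c i • q i with hp
    have hgp : ∀ y, g (y + R y) = p y := by
      intro y
      rw [hgc, hp]
      simp only [ContinuousLinearMap.sum_apply, ContinuousLinearMap.smul_apply, hfR]
    set s := sSup ((fun z => g z) '' {z : X1 | ‖z - R z‖ ≤ 1}) with hs
    have hinv : ∀ y, (y + R y) - R (y + R y) = y := fun y => by
      rw [map_add, hRR]; abel
    have hinv2 : ∀ y, (y - R y) + R (y - R y) = y := fun y => by
      rw [map_sub, hRR]; abel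
    have hbdd : BddAbove ((fun z => g z) '' {z : X1 | ‖z - R z‖ ≤ 1}) := by
      refine ⟨‖p‖, ?_⟩
      rintro _ ⟨z, hz, rfl⟩
      change g z ≤ _
      rw [← hinv2 z, hgp]
      refine (le_abs_self _).trans ((p.le_opNorm _).trans ?_)
      exact mul_le_of_le_one_right (norm_nonneg _) hz
    have hple : ∀ y, ‖y‖ ≤ 1 → p y ≤ s := by
      intro y hy
      rw [← hgp]
      refine le_csSup hbdd ⟨_, ?_, rfl⟩
      rw [Set.mem_setOf_eq, hinv]
      exact hy
    have hsj : ∀ j, |p (e1 j)| ≤ s := by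
      intro j
      refine abs_le'.2 ⟨hple _ (norm_e1 j).le, ?_⟩
      rw [← map_neg]
      exact hple _ (by rw [norm_neg, norm_e1])
    have hlt := key1 f q M K hK (by simp only [K]; linarith) hq c hc s hsj
    have := lt1 p s hlt (x - R x) hx
    rw [← hgp, hinv2, hgx] at this
    exact lt_irrefl _ this
end
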